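/- The derived group O_ρ of the permutation representation of the π-orbifold group O on ℤ/2 associated to P is isomorphic to the core group of the datum, i.e. to the group presented by generators A and relations u'(c) = o(c)·u(c)⁻¹·o(c) for all c ∈ C. -/

import Mathlib

/-- The defining relators of Crowell's derived group of the permutation
representation associated to a right action `act` of `G` on `Γ`:
`(γ, g*h) * ((γ, g) * (γ·g, h))⁻¹` for `g, h ∈ G` and `γ ∈ Γ`. -/
def derivedRels {Γ : Type*} {G : Type*} [Group G] (act : Γ → G → Γ) :
    Set (FreeGroup (Γ × G)) :=
  {r | ∃ (γ : Γ) (g h : G),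
    r = FreeGroup.of (γ, g * h) *
      (FreeGroup.of (γ, g) * FreeGroup.of (act γ g, h))⁻¹}

/-- Crowell's derived group `G_ρ`. -/
def DerivedGroup {Γ : Type*} {G : Type*} [Group G] (act : Γ → G → Γ) :=
  PresentedGroup (derivedRels act)

instance {Γ : Type*} {G : Type*} [Group G] (act : Γ → G → Γ) :
    Group (DerivedGroup act) :=
  inferInstanceAs (Group (PresentedGroup (derivedRels act)))

/-- The generator `g^γ` of the derived group. -/
def derivedGen {Γ : Type*} {G : Type*} [Group G] (act : Γ → G → Γ)
    (γ : Γ) (g : G) : DerivedGroup act :=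
  PresentedGroup.of (rels := derivedRels act) (γ, g)

section Wirtinger

variable {A C : Type*} (o u u' : C → A) (ε : C → ℤ)

/-- Wirtinger relators `u'(c)·(o(c)^{-ε(c)}·u(c)·o(c)^{ε(c)})⁻¹`. -/
def wirtingerRels : Set (FreeGroup A) :=
  {w | ∃ c : C, w = FreeGroup.of (u' c) *
    ((FreeGroup.of (o c)) ^ (-(ε c)) * FreeGroup.of (u c) *
      (FreeGroup.of (o c)) ^ (ε c))⁻¹}

/-- The knot group of a Wirtinger diagram datum. -/
def KnotGroup := PresentedGroup (wirtingerRels o u u' ε)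

instance : Group (KnotGroup o u u' ε) :=
  inferInstanceAs (Group (PresentedGroup (wirtingerRels o u u' ε)))

/-- The π-orbifold group: the knot group modulo the squares of the generators. -/
def OrbifoldGroup :=
  KnotGroup o u u' ε ⧸ Subgroup.normalClosure
    {z : KnotGroup o u u' ε | ∃ a : A,
      z = (PresentedGroup.of (rels := wirtingerRels o u u' ε) a) ^ 2}

instance : Group (OrbifoldGroup o u u' ε) :=
  inferInstanceAs (Group (KnotGroup o u u' ε ⧸ Subgroup.normalClosure
    {z : KnotGroup o u u' ε | ∃ a : A,
      z = (PresentedGroup.of (rels := wirtingerRels o u u' ε) a) ^ 2}))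

/-- The image of the arc generator `a` in the π-orbifold group. -/
def orbGen (a : A) : OrbifoldGroup o u u' ε :=
  QuotientGroup.mk' _ (PresentedGroup.of (rels := wirtingerRels o u u' ε) a)

/-- Core group relators `u'(c)·(o(c)·u(c)⁻¹·o(c))⁻¹`. -/
def coreRels : Set (FreeGroup A) :=
  {w | ∃ c : C, w = FreeGroup.of (u' c) *
    (FreeGroup.of (o c) * (FreeGroup.of (u c))⁻¹ * FreeGroup.of (o c))⁻¹}

theorem derivedGen_mul {Γ G : Type*} [Group G] (act : Γ → G → Γ) (γ : Γ) (g h : G) :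
    derivedGen act γ (g * h) = derivedGen act γ g * derivedGen act (act γ g) h := by
  rw [← mul_inv_eq_one]
  exact PresentedGroup.one_of_mem (rels := derivedRels act) ⟨γ, g, h, rfl⟩

theorem derivedGen_one {Γ G : Type*} [Group G] (act : Γ → G → Γ) (γ : Γ)
    (h : act γ 1 = γ) : derivedGen act γ (1 : G) = 1 := by
  have := derivedGen_mul act γ 1 1
  rwa [h, mul_one, left_eq_mul] at this

/-- A crossed map `c`, satisfying `c γ (g * h) = c γ g * c (γ * s g) h`, as a homomorphism into
the regular wreath product. -/
def crossedWreathHom {Γ G K : Type*} [CommGroup Γ] [Group G] [Group K] (s : G →* Γ)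
    (c : Γ → G → K) (hc : ∀ γ g h, c γ (g * h) = c γ g * c (γ * s g) h) :
    G →* K ≀ᵣ Γ :=
  MonoidHom.mk' (fun g => ⟨fun γ => c γ⁻¹ g, s g⟩) fun g h => by
    ext γ
    · simp [hc, mul_comm]
    · simp

theorem RegularWreathProduct.left_mul_inv {Γ K : Type*} [CommGroup Γ] [Group K]
    (x y : K ≀ᵣ Γ) (γ : Γ) :
    (x * y).left γ⁻¹ = x.left γ⁻¹ * y.left (γ * x.right)⁻¹ := by
  simp [mul_comm]

theorem eq_one_or_eq_ofAdd_one (γ : Multiplicative (ZMod 2)) :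
    γ = 1 ∨ γ = Multiplicative.ofAdd 1 := by
  revert γ
  decide

/-- The element `((k, k⁻¹), t)` of the wreath product of `K` with `ℤ/2`. -/
def alternatingElement {K : Type*} [Group K] (k : K) : K ≀ᵣ Multiplicative (ZMod 2) :=
  ⟨fun γ => if γ = 1 then k else k⁻¹, Multiplicative.ofAdd 1⟩

theorem alternatingElement_mul_self {K : Type*} [Group K] (k : K) :
    alternatingElement k * alternatingElement k = 1 := by
  ext γ
  · obtain rfl | rfl := eq_one_or_eq_ofAdd_one γ
    · simp [alternatingElement]
    · simp [alternatingElement]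
  · simp only [alternatingElement, RegularWreathProduct.mul_right, RegularWreathProduct.one_right]
    decide

theorem alternatingElement_conj {K : Type*} [Group K] (k l : K) :
    alternatingElement (k * l⁻¹ * k) =
      alternatingElement k * alternatingElement l * alternatingElement k := by
  have htt : (Multiplicative.ofAdd (1 : ZMod 2))⁻¹ * (Multiplicative.ofAdd 1)⁻¹ = 1 := by decide
  ext γ
  · obtain rfl | rfl := eq_one_or_eq_ofAdd_one γ
    · simp [alternatingElement, htt]
    · simp [alternatingElement, mul_assoc]
  · simp only [alternatingElement, RegularWreathProduct.mul_right]
    decide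

theorem zpow_neg_mul_mul_zpow_of_mul_self {G : Type*} [Group G] {x : G} (hx : x * x = 1)
    (y : G) {e : ℤ} (he : e = 1 ∨ e = -1) : x ^ (-e) * y * x ^ e = x * y * x := by
  have hinv : x⁻¹ = x := inv_eq_of_mul_eq_one_left hx
  obtain rfl | rfl := he <;> simp [hinv]

theorem orbGen_mul_self (a : A) : orbGen o u u' ε a * orbGen o u u' ε a = 1 := by
  rw [← sq]
  exact (QuotientGroup.eq_one_iff _).2 (Subgroup.subset_normalClosure ⟨a, rfl⟩)

theorem orbGen_outgoing (hε : ∀ c : C, ε c = 1 ∨ ε c = -1) (c : C) :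
    orbGen o u u' ε (u' c) =
      orbGen o u u' ε (o c) * orbGen o u u' ε (u c) * orbGen o u u' ε (o c) := by
  rw [← zpow_neg_mul_mul_zpow_of_mul_self (orbGen_mul_self o u u' ε (o c)) _ (hε c)]
  have h : PresentedGroup.mk (wirtingerRels o u u' ε) _ = 1 :=
    PresentedGroup.one_of_mem ⟨c, rfl⟩
  rw [map_mul, map_inv, mul_inv_eq_one, map_mul, map_mul, map_zpow, map_zpow] at h
  exact congrArg (QuotientGroup.mk' (Subgroup.normalClosure
    {z : KnotGroup o u u' ε | ∃ a : A,
      z = (PresentedGroup.of (rels := wirtingerRels o u u' ε) a) ^ 2})) h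

variable {o u u' ε} in
theorem OrbifoldGroup.hom_ext {G : Type*} [Group G] {f g : OrbifoldGroup o u u' ε →* G}
    (h : ∀ a, f (orbGen o u u' ε a) = g (orbGen o u u' ε a)) : f = g :=
  QuotientGroup.monoidHom_ext _ (PresentedGroup.ext h)

theorem OrbifoldGroup.exists_lift {G : Type*} [Group G]
    (hε : ∀ c : C, ε c = 1 ∨ ε c = -1) (f : A → G) (hsq : ∀ a, f a * f a = 1)
    (hf : ∀ c, f (u' c) = f (o c) * f (u c) * f (o c)) :
    ∃ F : OrbifoldGroup o u u' ε →* G, ∀ a, F (orbGen o u u' ε a) = f a := by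
  have hrel : ∀ r ∈ wirtingerRels o u u' ε, FreeGroup.lift f r = 1 := by
    rintro _ ⟨c, rfl⟩
    simp only [map_mul, map_inv, map_zpow, FreeGroup.lift_apply_of, mul_inv_eq_one]
    rw [zpow_neg_mul_mul_zpow_of_mul_self (hsq _) _ (hε c), hf]
  let F₀ : KnotGroup o u u' ε →* G := PresentedGroup.toGroup hrel
  have hF₀ (a : A) : F₀ (PresentedGroup.of (rels := wirtingerRels o u u' ε) a) = f a :=
    PresentedGroup.toGroup.of hrel
  refine ⟨QuotientGroup.lift _ F₀ (Subgroup.normalClosure_le_normal (N := F₀.ker) ?_), hF₀⟩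
  rintro _ ⟨a, rfl⟩
  refine (map_pow F₀ _ 2).trans ?_
  rw [hF₀, sq, hsq]

theorem core_outgoing (c : C) :
    PresentedGroup.of (rels := coreRels (C := C) o u u') (u' c) =
      PresentedGroup.of (o c) * (PresentedGroup.of (u c))⁻¹ * PresentedGroup.of (o c) := by
  rw [← mul_inv_eq_one]
  exact PresentedGroup.one_of_mem ⟨c, rfl⟩

/-- The derived group of the π-orbifold group's permutation representation on
`ℤ/2` is isomorphic to the core group. -/
theorem orbifold_derived_iso_core
    (hε : ∀ c : C, ε c = 1 ∨ ε c = -1)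
    (P : OrbifoldGroup o u u' ε →* Multiplicative (ZMod 2))
    (hP : ∀ a : A, P (orbGen o u u' ε a) = Multiplicative.ofAdd (1 : ZMod 2))
    (act : Multiplicative (ZMod 2) → OrbifoldGroup o u u' ε → Multiplicative (ZMod 2))
    (hact : ∀ (γ : Multiplicative (ZMod 2)) (g : OrbifoldGroup o u u' ε),
      act γ g = γ * P g) :
    Nonempty (DerivedGroup act ≃* PresentedGroup (coreRels (C := C) o u u')) := by
  have hmul (γ g h) : derivedGen act γ (g * h) =
      derivedGen act γ g * derivedGen act (γ * P g) h := by
    rw [derivedGen_mul, hact]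
  have hone (γ) : derivedGen act γ 1 = 1 := derivedGen_one act γ (by simp [hact])
  have hinv (a : A) : derivedGen act (Multiplicative.ofAdd 1) (orbGen o u u' ε a) =
      (derivedGen act 1 (orbGen o u u' ε a))⁻¹ := by
    have h := hmul 1 (orbGen o u u' ε a) (orbGen o u u' ε a)
    rw [orbGen_mul_self, hone, hP, one_mul] at h
    exact eq_inv_of_mul_eq_one_right h.symm
  have htt : Multiplicative.ofAdd (1 : ZMod 2) * Multiplicative.ofAdd 1 = 1 := by decide
  obtain ⟨F, hF⟩ := OrbifoldGroup.exists_lift o u u' ε hε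
    (fun a => alternatingElement (PresentedGroup.of (rels := coreRels (C := C) o u u') a))
    (fun a => alternatingElement_mul_self _)
    (fun c => by rw [core_outgoing, alternatingElement_conj])
  have hFP : RegularWreathProduct.rightHom.comp F = P :=
    OrbifoldGroup.hom_ext fun a => by simp [hF, hP, alternatingElement]
  have hFmul (γ g h) : (F (g * h)).left γ⁻¹ = (F g).left γ⁻¹ * (F h).left (γ * P g)⁻¹ := by
    rw [map_mul, RegularWreathProduct.left_mul_inv, ← hFP]
    rfl
  have hφ : ∀ r ∈ derivedRels act,
      FreeGroup.lift (fun p : _ × OrbifoldGroup o u u' ε => (F p.2).left p.1⁻¹) r = 1 := by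
    rintro _ ⟨γ, g, h, rfl⟩
    simp only [map_mul, map_inv, FreeGroup.lift_apply_of, mul_inv_eq_one, hact]
    simpa only [map_mul] using hFmul γ g h
  have hψ : ∀ r ∈ coreRels (C := C) o u u',
      FreeGroup.lift (fun a => derivedGen act 1 (orbGen o u u' ε a)) r = 1 := by
    rintro _ ⟨c, rfl⟩
    simp only [map_mul, map_inv, FreeGroup.lift_apply_of, mul_inv_eq_one]
    rw [orbGen_outgoing o u u' ε hε, hmul, hmul, map_mul, hP, hP, one_mul, one_mul, htt, hinv]
  let φ : DerivedGroup act →* PresentedGroup (coreRels (C := C) o u u') :=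
    PresentedGroup.toGroup hφ
  let ψ : PresentedGroup (coreRels (C := C) o u u') →* DerivedGroup act :=
    PresentedGroup.toGroup hψ
  have hφgen (γ g) : φ (derivedGen act γ g) = (F g).left γ⁻¹ := PresentedGroup.toGroup.of hφ
  have hψgen (a) : ψ (PresentedGroup.of a) = derivedGen act 1 (orbGen o u u' ε a) :=
    PresentedGroup.toGroup.of hψ
  have hcrossed : crossedWreathHom P (fun γ g => ψ ((F g).left γ⁻¹))
      (fun γ g h => by rw [hFmul, map_mul]) = crossedWreathHom P (derivedGen act) hmul := by
    refine OrbifoldGroup.hom_ext fun a => ?_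
    ext γ
    · obtain rfl | rfl := eq_one_or_eq_ofAdd_one γ
      · simp [crossedWreathHom, hF, alternatingElement, hψgen]
      · have ht : (Multiplicative.ofAdd (1 : ZMod 2))⁻¹ = Multiplicative.ofAdd 1 := by decide
        have hne : Multiplicative.ofAdd (1 : ZMod 2) ≠ 1 := by decide
        change ψ ((F _).left _) = derivedGen act _ _
        rw [hF, inv_inv, ht, hinv]
        simp only [alternatingElement, if_neg hne, map_inv, hψgen]
    · rfl
  have hψφ (γ g) : ψ ((F g).left γ⁻¹) = derivedGen act γ g := by
    have h := congrArg (fun f => (f g).left γ⁻¹) hcrossed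
    simpa [crossedWreathHom] using h
  refine ⟨MonoidHom.toMulEquiv φ ψ (PresentedGroup.ext fun p => ?_)
    (PresentedGroup.ext fun a => ?_)⟩
  · exact (congrArg ψ (hφgen p.1 p.2)).trans (hψφ p.1 p.2)
  · change φ (ψ (PresentedGroup.of a)) = PresentedGroup.of a
    rw [hψgen, hφgen, hF]
    simp [alternatingElement]

end Wirtinger
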